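/- arXiv:math/0609034 — 2 statements merged into one kernel-verified Lean document; each statement's English description precedes it below -/
import Mathlib

section
/- Lemma (symmetry of the modified Hopf-link pairing, sl(m|n) case): Let c, d ∈ ℕ^{m+n−2} and a, b ∈ ℂ be such that both λ = λ_a^c and μ = λ_b^d are typical. Then in the field ℂ((h)) of formal Laurent series one has d(μ)·S'(λ,μ) = d(λ)·S'(μ,λ). -/
/-!
Lemma (symmetry of the modified Hopf-link pairing, sl(m|n) case).
-/

open scoped BigOperators

noncomputable section

namespace SLmn

/-- The weight space `V = ℂ^{m+n}`, with coordinates `ε_1,…,ε_m,δ_1,…,δ_n`. -/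
abbrev V (m n : ℕ) := Fin (m + n) → ℂ

variable (m n : ℕ)

/-- The basis vector `ε_i` (here `i : Fin m` is the 0-based index). -/
def eps (i : Fin m) : V m n := Pi.single (Fin.castAdd n i) 1

/-- The basis vector `δ_j`. -/
def delta (j : Fin n) : V m n := Pi.single (Fin.natAdd m j) 1

/-- The symmetric bilinear form with `⟨ε_i,ε_j⟩ = δ_{ij}`, `⟨δ_i,δ_j⟩ = -δ_{ij}`,
`⟨ε_i,δ_j⟩ = 0`. -/
def form (x y : V m n) : ℂ :=
  (∑ i : Fin m, x (Fin.castAdd n i) * y (Fin.castAdd n i)) -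
    ∑ j : Fin n, x (Fin.natAdd m j) * y (Fin.natAdd m j)

/-- `ρ₀ = ½(Σ_i (m+1-2i)ε_i + Σ_j (n+1-2j)δ_j)` (1-based indices). -/
def rho0 : V m n :=
  (1 / 2 : ℂ) •
    ((∑ i : Fin m, ((m : ℂ) + 1 - 2 * ((i : ℕ) + 1)) • eps m n i) +
      ∑ j : Fin n, ((n : ℂ) + 1 - 2 * ((j : ℕ) + 1)) • delta m n j)

/-- `ρ₁ = ½(n Σ_i ε_i - m Σ_j δ_j)`. -/
def rho1 : V m n :=
  (1 / 2 : ℂ) • ((n : ℂ) • ∑ i : Fin m, eps m n i - (m : ℂ) • ∑ j : Fin n, delta m n j)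

/-- `ρ = ρ₀ - ρ₁`. -/
def rho : V m n := rho0 m n - rho1 m n

/-- The fundamental weight `w_k` (1-based `k`): `w_k = ε_1 + ⋯ + ε_k` for `1 ≤ k ≤ m`,
and `w_{m+k} = -(δ_{k+1} + ⋯ + δ_n)` for `1 ≤ k ≤ n-1`. -/
def w (k : ℕ) : V m n :=
  if k ≤ m then ∑ i ∈ Finset.univ.filter fun i : Fin m => (i : ℕ) < k, eps m n i
  else -∑ j ∈ Finset.univ.filter fun j : Fin n => k - m ≤ (j : ℕ), delta m n j

/-- The index of the fundamental weight attached to the `k`-th entry (0-based) of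
`c = (c_1,…,c_{m+n-2})`: `c_1,…,c_{m-1}` go with `w_1,…,w_{m-1}` and
`c_m,…,c_{m+n-2}` go with `w_{m+1},…,w_{m+n-1}`. -/
def wIdx (m k : ℕ) : ℕ := if k + 1 < m then k + 1 else k + 2

/-- The weight `λ_a^c = c_1 w_1 + ⋯ + c_{m-1} w_{m-1} + a·w_m + c_m w_{m+1} + ⋯ +
c_{m+n-2} w_{m+n-1}`. -/
def lam (c : Fin (m + n - 2) → ℕ) (a : ℂ) : V m n :=
  a • w m n m + ∑ k : Fin (m + n - 2), (c k : ℂ) • w m n (wIdx m k)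

/-- `λ` is typical if `⟨λ+ρ,α⟩ ≠ 0` for every odd positive root `α = ε_i - δ_j`. -/
def Typical (x : V m n) : Prop :=
  ∀ (i : Fin m) (j : Fin n), form m n (x + rho m n) (eps m n i - delta m n j) ≠ 0

/-- `exp(z h) ∈ ℂ[[h]]`. -/
def exph (z : ℂ) : PowerSeries ℂ := PowerSeries.mk fun j => z ^ j / (j.factorial : ℂ)

/-- `q^z := exp(zh/2)`. -/
def qpow (z : ℂ) : PowerSeries ℂ := exph (z / 2)

/-- `{z} := q^z - q^{-z}`. -/
def brace (z : ℂ) : PowerSeries ℂ := qpow z - qpow (-z)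

/-- `Π_{α ∈ Δ₀⁺} {⟨x,α⟩}` where `Δ₀⁺ = {ε_i-ε_j}_{i<j} ∪ {δ_i-δ_j}_{i<j}`. -/
def evenProd (x : V m n) : PowerSeries ℂ :=
  (∏ p ∈ Finset.univ.filter fun p : Fin m × Fin m => p.1 < p.2,
      brace (form m n x (eps m n p.1 - eps m n p.2))) *
    ∏ p ∈ Finset.univ.filter fun p : Fin n × Fin n => p.1 < p.2,
      brace (form m n x (delta m n p.1 - delta m n p.2))

/-- `Π_{α ∈ Δ₁⁺} {⟨x,α⟩}` where `Δ₁⁺ = {ε_i - δ_j}`. -/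
def oddProd (x : V m n) : PowerSeries ℂ :=
  ∏ p : Fin m × Fin n, brace (form m n x (eps m n p.1 - delta m n p.2))

/-- The action of `W = S_m × S_n` on `V`, permuting the `ε`-coordinates and the
`δ`-coordinates separately. -/
def act (σ : Equiv.Perm (Fin m)) (τ : Equiv.Perm (Fin n)) (x : V m n) : V m n :=
  fun k =>
    Sum.elim (fun i => x (Fin.castAdd n (σ⁻¹ i))) (fun j => x (Fin.natAdd m (τ⁻¹ j)))
      (finSumFinEquiv.symm k)

/-- The sign `ε(w) = sgn(σ)·sgn(τ)` of `w = (σ,τ) ∈ W`, as a complex number. -/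
def sgn (σ : Equiv.Perm (Fin m)) (τ : Equiv.Perm (Fin n)) : ℂ :=
  (((Equiv.Perm.sign σ : ℤ) * (Equiv.Perm.sign τ : ℤ) : ℤ) : ℂ)

/-- `N(λ,μ) = Σ_{w ∈ W} ε(w)·exp(⟨w(λ+ρ), μ+ρ⟩·h) ∈ ℂ[[h]]`. -/
def Npair (x y : V m n) : PowerSeries ℂ :=
  ∑ σ : Equiv.Perm (Fin m), ∑ τ : Equiv.Perm (Fin n),
    sgn m n σ τ • exph (form m n (act m n σ τ (x + rho m n)) (y + rho m n))

/-- The inclusion `ℂ[[h]] → ℂ((h))`. -/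
def toL : PowerSeries ℂ →+* LaurentSeries ℂ := HahnSeries.ofPowerSeries ℤ ℂ

/-- The fake quantum dimension
`d(λ) = (Π_{α∈Δ₀⁺} {⟨λ+ρ,α⟩}) / ((Π_{α∈Δ₁⁺} {⟨λ+ρ,α⟩})·(Π_{α∈Δ₀⁺} {⟨ρ,α⟩})) ∈ ℂ((h))`. -/
def dFake (x : V m n) : LaurentSeries ℂ :=
  toL (evenProd m n (x + rho m n)) /
    (toL (oddProd m n (x + rho m n)) * toL (evenProd m n (rho m n)))

/-- `Π_{α ∈ Δ₀⁺} {⟨α, y+ρ⟩}`. -/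
def evenProdR (y : V m n) : PowerSeries ℂ :=
  (∏ p ∈ Finset.univ.filter fun p : Fin m × Fin m => p.1 < p.2,
      brace (form m n (eps m n p.1 - eps m n p.2) (y + rho m n))) *
    ∏ p ∈ Finset.univ.filter fun p : Fin n × Fin n => p.1 < p.2,
      brace (form m n (delta m n p.1 - delta m n p.2) (y + rho m n))

/-- `Π_{α ∈ Δ₁⁺} {⟨α, y+ρ⟩}`. -/
def oddProdR (y : V m n) : PowerSeries ℂ :=
  ∏ p : Fin m × Fin n, brace (form m n (eps m n p.1 - delta m n p.2) (y + rho m n))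

/-- The modified Hopf-link pairing
`S'(λ,μ) = (Π_{α∈Δ₁⁺} {⟨α,μ+ρ⟩}) · N(λ,μ) / (Π_{α∈Δ₀⁺} {⟨α,μ+ρ⟩}) ∈ ℂ((h))`. -/
def Spair (x y : V m n) : LaurentSeries ℂ :=
  toL (oddProdR m n y) * toL (Npair m n x y) / toL (evenProdR m n y)

section Basis

variable {m n}

theorem eps_castAdd (i k : Fin m) :
    eps m n i (Fin.castAdd n k) = if k = i then 1 else 0 := by
  simp [eps, Pi.single_apply]

theorem eps_natAdd (i : Fin m) (k : Fin n) : eps m n i (Fin.natAdd m k) = 0 := by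
  have h : (m + k : ℕ) ≠ i := by omega
  simp [eps, Fin.ext_iff, h]

theorem delta_castAdd (j : Fin n) (k : Fin m) : delta m n j (Fin.castAdd n k) = 0 := by
  have h : (k : ℕ) ≠ m + j := by omega
  simp [delta, Fin.ext_iff, h]

theorem delta_natAdd (j k : Fin n) :
    delta m n j (Fin.natAdd m k) = if k = j then 1 else 0 := by
  simp [delta, Pi.single_apply]

end Basis

section Form

variable {m n}

theorem form_comm (x y : V m n) : form m n x y = form m n y x := by
  simp only [form, mul_comm]

theorem form_eps (x : V m n) (i : Fin m) : form m n x (eps m n i) = x (Fin.castAdd n i) := by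
  simp [form, eps_castAdd, eps_natAdd]

theorem form_delta (x : V m n) (j : Fin n) : form m n x (delta m n j) = -x (Fin.natAdd m j) := by
  simp [form, delta_castAdd, delta_natAdd]

theorem form_sub_right (x y z : V m n) :
    form m n x (y - z) = form m n x y - form m n x z := by
  simp only [form, Pi.sub_apply, mul_sub, Finset.sum_sub_distrib]
  ring

theorem form_act (σ : Equiv.Perm (Fin m)) (τ : Equiv.Perm (Fin n)) (x y : V m n) :
    form m n (act m n σ τ x) y = form m n (act m n σ⁻¹ τ⁻¹ y) x := by
  simp only [form, act, finSumFinEquiv_symm_apply_castAdd, finSumFinEquiv_symm_apply_natAdd,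
    Sum.elim_inl, Sum.elim_inr, inv_inv]
  congr 1
  · rw [← Equiv.sum_comp σ]
    simp [mul_comm]
  · rw [← Equiv.sum_comp τ]
    simp [mul_comm]

theorem sgn_inv (σ : Equiv.Perm (Fin m)) (τ : Equiv.Perm (Fin n)) :
    sgn m n σ⁻¹ τ⁻¹ = sgn m n σ τ := by
  simp [sgn]

theorem Npair_comm (x y : V m n) : Npair m n x y = Npair m n y x := by
  unfold Npair
  rw [← Equiv.sum_comp (Equiv.inv (Equiv.Perm (Fin m)))]
  refine Finset.sum_congr rfl fun σ _ => ?_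
  rw [← Equiv.sum_comp (Equiv.inv (Equiv.Perm (Fin n)))]
  refine Finset.sum_congr rfl fun τ _ => ?_
  simp only [Equiv.inv_apply]
  rw [sgn_inv, form_act, inv_inv, inv_inv]

theorem evenProdR_eq (y : V m n) : evenProdR m n y = evenProd m n (y + rho m n) := by
  simp only [evenProdR, evenProd, form_comm _ (y + rho m n)]

theorem oddProdR_eq (y : V m n) : oddProdR m n y = oddProd m n (y + rho m n) := by
  simp only [oddProdR, oddProd, form_comm _ (y + rho m n)]

end Form

theorem brace_ne_zero {z : ℂ} (hz : z ≠ 0) : brace z ≠ 0 := by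
  intro h
  have h1 := congrArg (PowerSeries.coeff 1) h
  simp only [brace, qpow, exph, map_sub, PowerSeries.coeff_mk, map_zero] at h1
  apply hz
  simpa [neg_div] using h1

theorem toL_injective : Function.Injective toL :=
  HahnSeries.ofPowerSeries_injective

section Coordinates

variable {m n}

theorem rho_castAdd (i : Fin m) :
    rho m n (Fin.castAdd n i) = ((m : ℂ) + 1 - 2 * ((i : ℕ) + 1) - n) / 2 := by
  simp [rho, rho0, rho1, Finset.sum_apply, eps_castAdd, delta_castAdd]
  ring

theorem rho_natAdd (j : Fin n) :
    rho m n (Fin.natAdd m j) = ((n : ℂ) + 1 - 2 * ((j : ℕ) + 1) + m) / 2 := by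
  simp [rho, rho0, rho1, Finset.sum_apply, eps_natAdd, delta_natAdd]
  ring

theorem w_castAdd (k : ℕ) (i : Fin m) :
    w m n k (Fin.castAdd n i) = if k ≤ m ∧ (i : ℕ) < k then 1 else 0 := by
  by_cases hk : k ≤ m <;>
    simp [w, hk, Finset.sum_apply, eps_castAdd, delta_castAdd]

theorem w_natAdd (k : ℕ) (j : Fin n) :
    w m n k (Fin.natAdd m j) = if m < k ∧ k - m ≤ (j : ℕ) then -1 else 0 := by
  by_cases hk : k ≤ m
  · simp [w, hk, Finset.sum_apply, eps_natAdd, hk.not_gt]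
  · simp only [w, hk, if_false, Pi.neg_apply, Finset.sum_apply, delta_natAdd, Finset.sum_ite_eq,
      Finset.mem_filter_univ, not_le.1 hk, true_and]
    split_ifs <;> simp

theorem exists_lam_castAdd_sub (c : Fin (m + n - 2) → ℕ) (a : ℂ) {i j : Fin m} (hij : i < j) :
    ∃ N : ℕ, lam m n c a (Fin.castAdd n i) - lam m n c a (Fin.castAdd n j) = N := by
  refine ⟨∑ k, c k * if wIdx m k ≤ m ∧ (i : ℕ) < wIdx m k ∧ wIdx m k ≤ j then 1 else 0, ?_⟩
  have key (k : ℕ) : w m n k (Fin.castAdd n i) - w m n k (Fin.castAdd n j) =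
      if k ≤ m ∧ (i : ℕ) < k ∧ k ≤ j then 1 else 0 := by
    rw [w_castAdd, w_castAdd]
    grind
  simp only [lam, Pi.add_apply, Pi.smul_apply, Finset.sum_apply, smul_eq_mul, Nat.cast_sum,
    Nat.cast_mul, Nat.cast_ite, Nat.cast_one, Nat.cast_zero, ← key, mul_sub,
    Finset.sum_sub_distrib]
  simp [w_castAdd]

theorem exists_lam_natAdd_sub (c : Fin (m + n - 2) → ℕ) (a : ℂ) {i j : Fin n} (hij : i < j) :
    ∃ N : ℕ, lam m n c a (Fin.natAdd m i) - lam m n c a (Fin.natAdd m j) = N := by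
  refine ⟨∑ k, c k * if m < wIdx m k ∧ (i : ℕ) < wIdx m k - m ∧ wIdx m k - m ≤ j
    then 1 else 0, ?_⟩
  have key (k : ℕ) : w m n k (Fin.natAdd m i) - w m n k (Fin.natAdd m j) =
      if m < k ∧ (i : ℕ) < k - m ∧ k - m ≤ j then 1 else 0 := by
    rw [w_natAdd, w_natAdd]
    grind
  simp only [lam, Pi.add_apply, Pi.smul_apply, Finset.sum_apply, smul_eq_mul, Nat.cast_sum,
    Nat.cast_mul, Nat.cast_ite, Nat.cast_one, Nat.cast_zero, ← key, mul_sub,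
    Finset.sum_sub_distrib]
  simp [w_natAdd]

theorem natCast_add_sub_ne_zero (N : ℕ) {i j : ℕ} (hij : i < j) :
    (N : ℂ) + ((j : ℂ) - i) ≠ 0 := by
  rw [← Nat.cast_sub hij.le, ← Nat.cast_add, Nat.cast_ne_zero]
  omega

theorem evenProd_lam_ne_zero (c : Fin (m + n - 2) → ℕ) (a : ℂ) :
    evenProd m n (lam m n c a + rho m n) ≠ 0 := by
  refine mul_ne_zero (Finset.prod_ne_zero_iff.2 fun p hp => brace_ne_zero ?_)
    (Finset.prod_ne_zero_iff.2 fun p hp => brace_ne_zero ?_)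
  · have hlt := (Finset.mem_filter.1 hp).2
    obtain ⟨N, hN⟩ := exists_lam_castAdd_sub (n := n) c a hlt
    rw [form_sub_right, form_eps, form_eps, Pi.add_apply, Pi.add_apply, rho_castAdd, rho_castAdd]
    convert natCast_add_sub_ne_zero N hlt using 1
    rw [← hN]
    ring
  · have hlt := (Finset.mem_filter.1 hp).2
    obtain ⟨N, hN⟩ := exists_lam_natAdd_sub (m := m) c a hlt
    rw [form_sub_right, form_delta, form_delta, Pi.add_apply, Pi.add_apply, rho_natAdd,
      rho_natAdd]
    convert neg_ne_zero.2 (natCast_add_sub_ne_zero N hlt) using 1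
    rw [← hN]
    ring

theorem Typical.oddProd_ne_zero {x : V m n} (hx : Typical m n x) :
    oddProd m n (x + rho m n) ≠ 0 :=
  Finset.prod_ne_zero_iff.2 fun p _ => brace_ne_zero (hx p.1 p.2)

end Coordinates

/-- For typical `y` with `Π_{α ∈ Δ₀⁺} {⟨y+ρ,α⟩} ≠ 0`, all factors depending on `y` alone cancel
in `d(y)·S'(x,y)`. -/
theorem dFake_mul_Spair (x : V m n) {y : V m n} (hy : Typical m n y)
    (hy' : evenProd m n (y + rho m n) ≠ 0) :
    dFake m n y * Spair m n x y = toL (Npair m n x y) / toL (evenProd m n (rho m n)) := by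
  have hO := (map_ne_zero_iff toL toL_injective).2 hy.oddProd_ne_zero
  have hE := (map_ne_zero_iff toL toL_injective).2 hy'
  rw [dFake, Spair, evenProdR_eq, oddProdR_eq, div_mul_div_comm]
  rw [← mul_div_mul_left (toL (Npair m n x y)) _ (mul_ne_zero hE hO)]
  congr 1 <;> ring

/-- Lemma (symmetry of the modified Hopf-link pairing, sl(m|n) case): if
`λ = λ_a^c` and `μ = λ_b^d` are typical, then in `ℂ((h))` one has
`d(μ)·S'(λ,μ) = d(λ)·S'(μ,λ)`. -/
theorem hopf_pairing_symmetry (hm : 1 ≤ m) (hn : 1 ≤ n) (hmn : m ≠ n)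
    (c d : Fin (m + n - 2) → ℕ) (a b : ℂ)
    (hlam : Typical m n (lam m n c a)) (hmu : Typical m n (lam m n d b)) :
    dFake m n (lam m n d b) * Spair m n (lam m n c a) (lam m n d b) =
      dFake m n (lam m n c a) * Spair m n (lam m n d b) (lam m n c a) := by
  rw [dFake_mul_Spair m n _ hmu (evenProd_lam_ne_zero d b),
    dFake_mul_Spair m n _ hlam (evenProd_lam_ne_zero c a), Npair_comm]

end SLmn
end
end

section
/- Lemma (symmetry of the modified Hopf-link pairing, osp(2|2n) case): Let c, d ∈ ℕ^n and a, b ∈ ℂ be such that both λ = λ_a^c and μ = λ_b^d are typical. Then in the field ℂ((h)) of formal Laurent series one has d(μ)·S'(λ,μ) = d(λ)·S'(μ,λ). -/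
/-!
Lemma (symmetry of the modified Hopf-link pairing, osp(2|2n) case).
-/

open scoped BigOperators

noncomputable section

namespace Osp

/-- The weight space `V = ℂ^{1+n}`, with coordinates `ε, δ_1,…,δ_n`. -/
abbrev V (n : ℕ) := Fin (n + 1) → ℂ

variable (n : ℕ)

/-- The basis vector `ε`. -/
def eps : V n := Pi.single 0 1

/-- The basis vector `δ_j`. -/
def delta (j : Fin n) : V n := Pi.single j.succ 1

/-- The symmetric bilinear form with `⟨ε,ε⟩ = 1`, `⟨δ_i,δ_j⟩ = -δ_{ij}`, `⟨ε,δ_i⟩ = 0`. -/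
def form (x y : V n) : ℂ := x 0 * y 0 - ∑ j : Fin n, x j.succ * y j.succ

/-- `ρ₀ = Σ_i (n+1-i)δ_i` (1-based index `i`). -/
def rho0 : V n := ∑ j : Fin n, ((n : ℂ) + 1 - ((j : ℕ) + 1)) • delta n j

/-- `ρ₁ = n·ε`. -/
def rho1 : V n := (n : ℂ) • eps n

/-- `ρ = ρ₀ - ρ₁`. -/
def rho : V n := rho0 n - rho1 n

/-- The fundamental weight `w_{k+1} = ε + δ_1 + ⋯ + δ_k` for `0 ≤ k ≤ n`
(so `w 0 = w_1 = ε`). -/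
def w (k : ℕ) : V n :=
  eps n + ∑ j ∈ Finset.univ.filter fun j : Fin n => (j : ℕ) < k, delta n j

/-- The weight `λ_a^c = a·w_1 + c_1 w_2 + ⋯ + c_n w_{n+1}`. -/
def lam (c : Fin n → ℕ) (a : ℂ) : V n :=
  a • w n 0 + ∑ k : Fin n, (c k : ℂ) • w n ((k : ℕ) + 1)

/-- `λ` is typical if `⟨λ+ρ,α⟩ ≠ 0` for every odd positive root `α = ε ∓ δ_i`. -/
def Typical (x : V n) : Prop :=
  ∀ i : Fin n,
    form n (x + rho n) (eps n - delta n i) ≠ 0 ∧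
      form n (x + rho n) (eps n + delta n i) ≠ 0

/-- `exp(z h) ∈ ℂ[[h]]`. -/
def exph (z : ℂ) : PowerSeries ℂ := PowerSeries.mk fun j => z ^ j / (j.factorial : ℂ)

/-- `q^z := exp(zh/2)`. -/
def qpow (z : ℂ) : PowerSeries ℂ := exph (z / 2)

/-- `{z} := q^z - q^{-z}`. -/
def brace (z : ℂ) : PowerSeries ℂ := qpow z - qpow (-z)

/-- `Π_{α ∈ Δ₀⁺} {⟨x,α⟩}` where
`Δ₀⁺ = {δ_i-δ_j}_{i<j} ∪ {δ_i+δ_j}_{i<j} ∪ {2δ_i}`. -/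
def evenProd (x : V n) : PowerSeries ℂ :=
  (∏ p ∈ Finset.univ.filter fun p : Fin n × Fin n => p.1 < p.2,
      brace (form n x (delta n p.1 - delta n p.2))) *
    (∏ p ∈ Finset.univ.filter fun p : Fin n × Fin n => p.1 < p.2,
      brace (form n x (delta n p.1 + delta n p.2))) *
    ∏ i : Fin n, brace (form n x ((2 : ℂ) • delta n i))

/-- `Π_{α ∈ Δ₁⁺} {⟨x,α⟩}` where `Δ₁⁺ = {ε - δ_i} ∪ {ε + δ_i}`. -/
def oddProd (x : V n) : PowerSeries ℂ :=
  (∏ i : Fin n, brace (form n x (eps n - delta n i))) *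
    ∏ i : Fin n, brace (form n x (eps n + delta n i))

/-- The action on `V` of the element of the Weyl group `W = (ℤ/2)^n ⋊ S_n` of `sp(2n)`
given by signs `s : Fin n → Bool` (`true` = `+1`, `false` = `-1`) and a permutation
`σ`: it fixes `ε`, permutes the `δ`-coordinates and changes their signs. -/
def act (s : Fin n → Bool) (σ : Equiv.Perm (Fin n)) (x : V n) : V n :=
  fun k =>
    Fin.cases (x 0) (fun j => (if s j then (1 : ℂ) else -1) * x (σ⁻¹ j).succ) k

/-- The sign `ε(w) = det(w)` of the Weyl group element `w = (s,σ)`. -/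
def sgn (s : Fin n → Bool) (σ : Equiv.Perm (Fin n)) : ℂ :=
  ((Equiv.Perm.sign σ : ℤ) : ℂ) * ∏ j : Fin n, (if s j then (1 : ℂ) else -1)

/-- `N(λ,μ) = Σ_{w ∈ W} ε(w)·exp(⟨w(λ+ρ), μ+ρ⟩·h) ∈ ℂ[[h]]`. -/
def Npair (x y : V n) : PowerSeries ℂ :=
  ∑ s : Fin n → Bool, ∑ σ : Equiv.Perm (Fin n),
    sgn n s σ • exph (form n (act n s σ (x + rho n)) (y + rho n))

/-- The inclusion `ℂ[[h]] → ℂ((h))`. -/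
def toL : PowerSeries ℂ →+* LaurentSeries ℂ := HahnSeries.ofPowerSeries ℤ ℂ

/-- The fake quantum dimension
`d(λ) = (Π_{α∈Δ₀⁺} {⟨λ+ρ,α⟩}) / ((Π_{α∈Δ₁⁺} {⟨λ+ρ,α⟩})·(Π_{α∈Δ₀⁺} {⟨ρ,α⟩})) ∈ ℂ((h))`. -/
def dFake (x : V n) : LaurentSeries ℂ :=
  toL (evenProd n (x + rho n)) /
    (toL (oddProd n (x + rho n)) * toL (evenProd n (rho n)))

/-- `Π_{α ∈ Δ₀⁺} {⟨α, y+ρ⟩}`. -/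
def evenProdR (y : V n) : PowerSeries ℂ :=
  (∏ p ∈ Finset.univ.filter fun p : Fin n × Fin n => p.1 < p.2,
      brace (form n (delta n p.1 - delta n p.2) (y + rho n))) *
    (∏ p ∈ Finset.univ.filter fun p : Fin n × Fin n => p.1 < p.2,
      brace (form n (delta n p.1 + delta n p.2) (y + rho n))) *
    ∏ i : Fin n, brace (form n ((2 : ℂ) • delta n i) (y + rho n))

/-- `Π_{α ∈ Δ₁⁺} {⟨α, y+ρ⟩}`. -/
def oddProdR (y : V n) : PowerSeries ℂ :=
  (∏ i : Fin n, brace (form n (eps n - delta n i) (y + rho n))) *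
    ∏ i : Fin n, brace (form n (eps n + delta n i) (y + rho n))

/-- The modified Hopf-link pairing
`S'(λ,μ) = (Π_{α∈Δ₁⁺} {⟨α,μ+ρ⟩}) · N(λ,μ) / (Π_{α∈Δ₀⁺} {⟨α,μ+ρ⟩}) ∈ ℂ((h))`. -/
def Spair (x y : V n) : LaurentSeries ℂ :=
  toL (oddProdR n y) * toL (Npair n x y) / toL (evenProdR n y)

lemma form_comm (x y : V n) : form n x y = form n y x := by
  simp only [form, mul_comm]

lemma form_eps_sub_delta (x : V n) (i : Fin n) :
    form n x (eps n - delta n i) = x 0 + x i.succ := by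
  simp [form, eps, delta, Pi.single_apply, (Fin.succ_ne_zero _).symm]

lemma form_eps_add_delta (x : V n) (i : Fin n) :
    form n x (eps n + delta n i) = x 0 - x i.succ := by
  simp [form, eps, delta, Pi.single_apply, (Fin.succ_ne_zero _).symm]

lemma form_delta_sub_delta (x : V n) (i j : Fin n) :
    form n x (delta n i - delta n j) = x j.succ - x i.succ := by
  simp [form, delta, Pi.single_apply, (Fin.succ_ne_zero _).symm, mul_sub,
    Finset.sum_sub_distrib]

lemma form_delta_add_delta (x : V n) (i j : Fin n) :
    form n x (delta n i + delta n j) = -(x i.succ + x j.succ) := by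
  simp [form, delta, Pi.single_apply, (Fin.succ_ne_zero _).symm, mul_add,
    Finset.sum_add_distrib]

lemma form_two_smul_delta (x : V n) (i : Fin n) :
    form n x ((2 : ℂ) • delta n i) = -(x i.succ * 2) := by
  simp [form, delta, Pi.single_apply, (Fin.succ_ne_zero _).symm]

lemma evenProdR_eq (y : V n) : evenProdR n y = evenProd n (y + rho n) := by
  simp only [evenProdR, evenProd, form_comm n _ (y + rho n)]

lemma oddProdR_eq (y : V n) : oddProdR n y = oddProd n (y + rho n) := by
  simp only [oddProdR, oddProd, form_comm n _ (y + rho n)]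

lemma brace_ne_zero {z : ℂ} (hz : z ≠ 0) : brace z ≠ 0 := by
  intro h
  have h1 := congrArg (PowerSeries.coeff 1) h
  simp only [brace, qpow, exph, map_sub, PowerSeries.coeff_mk, map_zero, pow_one,
    Nat.factorial_one, Nat.cast_one, div_one] at h1
  exact hz (by linear_combination h1)

lemma oddProd_ne_zero {x : V n} (hx : Typical n x) : oddProd n (x + rho n) ≠ 0 :=
  mul_ne_zero (Finset.prod_ne_zero_iff.2 fun i _ => brace_ne_zero (hx i).1)
    (Finset.prod_ne_zero_iff.2 fun i _ => brace_ne_zero (hx i).2)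

/-- The `δ_j`-coordinate of `λ_a^c + ρ`, as a natural number. -/
def shiftedCoord (c : Fin n → ℕ) (j : Fin n) : ℕ :=
  (∑ k : Fin n, if j ≤ k then c k else 0) + (n - j)

lemma lam_add_rho_succ (c : Fin n → ℕ) (a : ℂ) (j : Fin n) :
    (lam n c a + rho n) j.succ = (shiftedCoord n c j : ℂ) := by
  simp [lam, rho, rho0, rho1, w, eps, delta, shiftedCoord, Pi.single_apply,
    Finset.sum_apply, Nat.cast_sub j.is_le']

lemma shiftedCoord_pos (c : Fin n → ℕ) (j : Fin n) : 0 < shiftedCoord n c j := by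
  have := j.is_lt
  unfold shiftedCoord
  omega

lemma shiftedCoord_lt (c : Fin n → ℕ) {i j : Fin n} (hij : i < j) :
    shiftedCoord n c j < shiftedCoord n c i := by
  have h : (∑ k : Fin n, if j ≤ k then c k else 0) ≤ ∑ k : Fin n, if i ≤ k then c k else 0 := by
    refine Finset.sum_le_sum fun k _ => ?_
    by_cases hk : j ≤ k
    · simp [hk, hij.le.trans hk]
    · simp [hk]
  have := j.is_lt
  have : (i : ℕ) < j := hij
  unfold shiftedCoord
  omega

lemma evenProd_lam_ne_zero (c : Fin n → ℕ) (a : ℂ) :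
    evenProd n (lam n c a + rho n) ≠ 0 := by
  refine mul_ne_zero (mul_ne_zero ?_ ?_) ?_ <;>
    refine Finset.prod_ne_zero_iff.2 fun p hp => brace_ne_zero ?_
  · rw [form_delta_sub_delta, lam_add_rho_succ, lam_add_rho_succ, sub_ne_zero]
    exact_mod_cast (shiftedCoord_lt n c (Finset.mem_filter.1 hp).2).ne
  · rw [form_delta_add_delta, lam_add_rho_succ, lam_add_rho_succ, neg_ne_zero]
    have := shiftedCoord_pos n c p.1
    exact_mod_cast (by omega : shiftedCoord n c p.1 + shiftedCoord n c p.2 ≠ 0)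
  · rw [form_two_smul_delta, lam_add_rho_succ, neg_ne_zero]
    have := shiftedCoord_pos n c p
    exact_mod_cast (by omega : shiftedCoord n c p * 2 ≠ 0)

lemma form_act (s : Fin n → Bool) (σ : Equiv.Perm (Fin n)) (x y : V n) :
    form n (act n s σ x) y = form n (act n (s ∘ σ) σ⁻¹ y) x := by
  simp only [form, act, Fin.cases_zero, Fin.cases_succ, inv_inv, Function.comp_apply]
  rw [mul_comm (x 0), ← Equiv.sum_comp σ]
  congr 1
  refine Finset.sum_congr rfl fun j _ => ?_
  rw [show σ⁻¹ (σ j) = j from σ.symm_apply_apply j]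
  ring

lemma sgn_comp_inv (s : Fin n → Bool) (σ : Equiv.Perm (Fin n)) :
    sgn n (s ∘ σ) σ⁻¹ = sgn n s σ := by
  simp only [sgn, Equiv.Perm.sign_inv, Function.comp_apply]
  rw [Equiv.prod_comp σ fun j => if s j then (1 : ℂ) else -1]

lemma Npair_comm (x y : V n) : Npair n x y = Npair n y x := by
  unfold Npair
  rw [Finset.sum_comm, Finset.sum_comm (γ := Fin n → Bool),
    ← Equiv.sum_comp (Equiv.inv (Equiv.Perm (Fin n)))]
  refine Finset.sum_congr rfl fun σ _ => ?_
  rw [← Equiv.sum_comp (Equiv.arrowCongr σ.symm (Equiv.refl Bool))]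
  refine Finset.sum_congr rfl fun s _ => ?_
  have hs : (Equiv.arrowCongr σ.symm (Equiv.refl Bool)) s = s ∘ σ := rfl
  rw [hs, Equiv.inv_apply, sgn_comp_inv, ← form_act]

lemma toL_ne_zero {f : PowerSeries ℂ} (hf : f ≠ 0) : toL f ≠ 0 :=
  (map_ne_zero_iff toL HahnSeries.ofPowerSeries_injective).2 hf

lemma dFake_mul_Spair (x : V n) {y : V n} (hodd : oddProd n (y + rho n) ≠ 0)
    (heven : evenProd n (y + rho n) ≠ 0) :
    dFake n y * Spair n x y = toL (Npair n x y) / toL (evenProd n (rho n)) := by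
  rw [dFake, Spair, evenProdR_eq, oddProdR_eq]
  have h₁ := toL_ne_zero hodd
  have h₂ := toL_ne_zero heven
  generalize toL (evenProd n (rho n)) = e
  rw [div_mul_div_comm, mul_left_comm, mul_assoc,
    mul_div_mul_left _ _ h₁, mul_comm e, mul_div_mul_left _ _ h₂]

/-- Lemma (symmetry of the modified Hopf-link pairing, osp(2|2n) case): if
`λ = λ_a^c` and `μ = λ_b^d` are typical, then in `ℂ((h))` one has
`d(μ)·S'(λ,μ) = d(λ)·S'(μ,λ)`. -/
theorem hopf_pairing_symmetry (hn : 1 ≤ n)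
    (c d : Fin n → ℕ) (a b : ℂ)
    (hlam : Typical n (lam n c a)) (hmu : Typical n (lam n d b)) :
    dFake n (lam n d b) * Spair n (lam n c a) (lam n d b) =
      dFake n (lam n c a) * Spair n (lam n d b) (lam n c a) := by
  rw [dFake_mul_Spair n _ (oddProd_ne_zero n hmu) (evenProd_lam_ne_zero n d b),
    dFake_mul_Spair n _ (oddProd_ne_zero n hlam) (evenProd_lam_ne_zero n c a), Npair_comm]

end Osp
end
end
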